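/- Let L be a smooth real-valued function on an open set S ⊆ C satisfying the Lindström–Roček constraints ∇_I · ∇_J L = 0 and ∇_I × ∇_J L = 0⃗ for all I, J ∈ Fin m. Define on S the Higgs field U_{IJ} := −½ ∂_{I,1}∂_{J,1} L and the complex function G := L₁(L) + i(L₀(L) − L). Then the following two conditions are equivalent: (a) for all I, J ∈ Fin m, ∂_{I,1}∂_{J,1} G = 0 and ∂_{z^I}∂_{J,1} G = 0 on S, where ∂_{z^I} := ∂_{I,2} − i ∂_{I,3}; (b) for all I, J ∈ Fin m, L_k U_{IJ} = 0 on S for k = 1,2,3 and L₀ U_{IJ} = −U_{IJ} on S. -/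

import Mathlib

/-- The configuration space of `m` points in `ℝ³`. -/
abbrev Conf (m : ℕ) := Fin m → Fin 3 → ℝ

/-- Standard basis vector `e_{K,i}` of the configuration space. -/
noncomputable def e {m : ℕ} (K : Fin m) (i : Fin 3) : Conf m :=
  Pi.single K (Pi.single i 1)

/-- The partial derivative `∂_{K,i}` along the basis vector `e_{K,i}`. -/
noncomputable def pd {m : ℕ} (K : Fin m) (i : Fin 3) (f : Conf m → ℝ) : Conf m → ℝ :=
  fun x => fderiv ℝ f x (e K i)

/-- Standard dot product on `ℝ³`. -/
noncomputable def dot3 (a b : Fin 3 → ℝ) : ℝ := ∑ i, a i * b i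

/-- The Levi-Civita symbol on `Fin 3`, with `ε 0 1 2 = 1`. -/
noncomputable def eps (k i j : Fin 3) : ℝ :=
  ((i : ℝ) - (k : ℝ)) * ((j : ℝ) - (k : ℝ)) * ((j : ℝ) - (i : ℝ)) / 2

/-- Standard cross product on `ℝ³`: `(a × b)_k = ∑_{i,j} ε_{kij} aᵢ bⱼ`. -/
noncomputable def cross3 (a b : Fin 3 → ℝ) : Fin 3 → ℝ :=
  fun k => ∑ i, ∑ j, eps k i j * a i * b j

/-- `∇_K f` : the `ℝ³`-valued gradient with respect to the `K`-th point. -/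
noncomputable def grad {m : ℕ} (K : Fin m) (f : Conf m → ℝ) : Conf m → Fin 3 → ℝ :=
  fun x i => pd K i f x

/-- The generator of simultaneous scalings: `L₀ f = ∑_K x⃗^K · ∇_K f`. -/
noncomputable def L0 {m : ℕ} (f : Conf m → ℝ) : Conf m → ℝ :=
  fun x => ∑ K, dot3 (x K) (grad K f x)

/-- The generators of rigid rotations: `Lᵢ f = −∑_K (x⃗^K × ∇_K f)ᵢ`,
for `i = 0, 1, 2` (playing the role of `1, 2, 3`). -/
noncomputable def Lrot {m : ℕ} (i : Fin 3) (f : Conf m → ℝ) : Conf m → ℝ :=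
  fun x => -∑ K, cross3 (x K) (grad K f x) i

/-- Complex-valued partial derivative `∂_{K,i}` (the ℂ-linear extension). -/
noncomputable def pdC {m : ℕ} (K : Fin m) (i : Fin 3) (f : Conf m → ℂ) : Conf m → ℂ :=
  fun x => fderiv ℝ f x (e K i)

/-- The ℂ-linear extension of the scaling generator `L₀`. -/
noncomputable def L0C {m : ℕ} (f : Conf m → ℂ) : Conf m → ℂ :=
  fun x => ∑ K, ∑ i, (x K i : ℂ) * pdC K i f x

/-- The ℂ-linear extension of the rotation generators `Lᵢ`. -/
noncomputable def LrotC {m : ℕ} (k : Fin 3) (f : Conf m → ℂ) : Conf m → ℂ :=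
  fun x => -∑ K, ∑ i, ∑ j, (eps k i j : ℂ) * (x K i : ℂ) * pdC K j f x

section Derivatives

variable {m : ℕ} {S : Set (Conf m)} {f g : Conf m → ℝ} {x : Conf m}

theorem differentiableAt_of_smoothOn (hS : IsOpen S) (hf : ContDiffOn ℝ (⊤ : ℕ∞) f S)
    (hx : x ∈ S) : DifferentiableAt ℝ f x :=
  (hf.contDiffAt (hS.mem_nhds hx)).differentiableAt (by simp)

theorem contDiffOn_pd (hS : IsOpen S) (hf : ContDiffOn ℝ (⊤ : ℕ∞) f S) (K : Fin m) (i : Fin 3) :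
    ContDiffOn ℝ (⊤ : ℕ∞) (pd K i f) S :=
  (hf.fderiv_of_isOpen hS (by simp)).clm_apply contDiffOn_const

theorem pd_congr (hS : IsOpen S) (h : ∀ y ∈ S, f y = g y) (hx : x ∈ S) (K : Fin m) (i : Fin 3) :
    pd K i f x = pd K i g x := by
  have h' : f =ᶠ[nhds x] g := Filter.eventually_of_mem (hS.mem_nhds hx) h
  simp only [pd, h'.fderiv_eq]

theorem pd_comm (hS : IsOpen S) (hf : ContDiffOn ℝ (⊤ : ℕ∞) f S) (hx : x ∈ S)
    (I J : Fin m) (i j : Fin 3) : pd I i (pd J j f) x = pd J j (pd I i f) x := by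
  have hd : DifferentiableAt ℝ (fderiv ℝ f) x :=
    ((hf.fderiv_of_isOpen hS (m := (⊤ : ℕ∞)) (by simp)).contDiffAt
      (hS.mem_nhds hx)).differentiableAt (by simp)
  have key (u v : Conf m) :
      fderiv ℝ (fun y => fderiv ℝ f y u) x v = fderiv ℝ (fderiv ℝ f) x v u := by
    rw [fderiv_clm_apply hd (differentiableAt_const u)]
    simp
  have hsymm : IsSymmSndFDerivAt ℝ f x :=
    (hf.contDiffAt (hS.mem_nhds hx)).isSymmSndFDerivAt (by
      simpa using WithTop.coe_le_coe.2 (le_top : (2 : ℕ∞) ≤ ⊤))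
  unfold pd
  rw [key, key]
  exact hsymm _ _

theorem pd_const_mul (hf : DifferentiableAt ℝ f x) (c : ℝ) (K : Fin m) (i : Fin 3) :
    pd K i (fun y => c * f y) x = c * pd K i f x := by
  simp [pd, fderiv_const_mul hf]

theorem pd_add (hf : DifferentiableAt ℝ f x) (hg : DifferentiableAt ℝ g x) (K : Fin m)
    (i : Fin 3) : pd K i (fun y => f y + g y) x = pd K i f x + pd K i g x := by
  simp [pd, fderiv_fun_add hf hg]

theorem pd_sub (hf : DifferentiableAt ℝ f x) (hg : DifferentiableAt ℝ g x) (K : Fin m)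
    (i : Fin 3) : pd K i (fun y => f y - g y) x = pd K i f x - pd K i g x := by
  simp [pd, fderiv_fun_sub hf hg]

theorem pd_sum {ι : Type*} (s : Finset ι) {F : ι → Conf m → ℝ}
    (hF : ∀ k ∈ s, DifferentiableAt ℝ (F k) x) (K : Fin m) (i : Fin 3) :
    pd K i (fun y => ∑ k ∈ s, F k y) x = ∑ k ∈ s, pd K i (F k) x := by
  simp [pd, fderiv_fun_sum hF]

theorem pd_mul (hf : DifferentiableAt ℝ f x) (hg : DifferentiableAt ℝ g x) (K : Fin m)
    (i : Fin 3) : pd K i (fun y => f y * g y) x = pd K i f x * g x + f x * pd K i g x := by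
  simp [pd, fderiv_fun_mul hf hg]
  ring

theorem pd_coord (J K : Fin m) (i j : Fin 3) :
    pd J j (fun y => y K i) x = if K = J ∧ i = j then 1 else 0 := by
  have h : HasFDerivAt (fun y : Conf m => y K i)
      ((ContinuousLinearMap.proj i : (Fin 3 → ℝ) →L[ℝ] ℝ).comp (ContinuousLinearMap.proj K)) x :=
    ((ContinuousLinearMap.proj i : (Fin 3 → ℝ) →L[ℝ] ℝ).comp
      (ContinuousLinearMap.proj K : Conf m →L[ℝ] (Fin 3 → ℝ))).hasFDerivAt
  rw [pd, h.fderiv]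
  by_cases hK : K = J
  · subst hK
    simp [e, Pi.single_apply]
  · simp [e, hK]

/-- The collective linear vector field `∑_K ∑_{i,j} A i j x^K_i ∂_{K,j}`. -/
noncomputable def collective (A : Fin 3 → Fin 3 → ℝ) (f : Conf m → ℝ) : Conf m → ℝ :=
  fun x => ∑ K, ∑ i, ∑ j, A i j * x K i * pd K j f x

theorem L0_eq_collective (f : Conf m → ℝ) :
    L0 f = collective (fun i j => if i = j then 1 else 0) f := by
  funext x
  simp [L0, collective, dot3, grad]

theorem Lrot_eq_collective (k : Fin 3) (f : Conf m → ℝ) :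
    Lrot k f = collective (fun i j => -eps k i j) f := by
  funext x
  simp [Lrot, collective, cross3, grad]

theorem contDiffOn_collective (hS : IsOpen S) (hf : ContDiffOn ℝ (⊤ : ℕ∞) f S)
    (A : Fin 3 → Fin 3 → ℝ) : ContDiffOn ℝ (⊤ : ℕ∞) (collective A f) S := by
  refine ContDiffOn.sum fun K _ => ContDiffOn.sum fun i _ => ContDiffOn.sum fun j _ => ?_
  have h : ContDiff ℝ (⊤ : ℕ∞) fun y : Conf m => A i j * y K i := by fun_prop
  exact h.contDiffOn.mul (contDiffOn_pd hS hf K j)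

theorem collective_const_mul (hS : IsOpen S) (hf : ContDiffOn ℝ (⊤ : ℕ∞) f S) (hx : x ∈ S)
    (A : Fin 3 → Fin 3 → ℝ) (c : ℝ) :
    collective A (fun y => c * f y) x = c * collective A f x := by
  simp only [collective, pd_const_mul (differentiableAt_of_smoothOn hS hf hx), Finset.mul_sum]
  refine Finset.sum_congr rfl fun K _ => Finset.sum_congr rfl fun i _ =>
    Finset.sum_congr rfl fun j _ => by ring

theorem pd_collective (hS : IsOpen S) (hf : ContDiffOn ℝ (⊤ : ℕ∞) f S) (hx : x ∈ S)
    (A : Fin 3 → Fin 3 → ℝ) (J : Fin m) (a : Fin 3) :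
    pd J a (collective A f) x = ∑ j, A a j * pd J j f x + collective A (pd J a f) x := by
  have hpd (K : Fin m) (j : Fin 3) : DifferentiableAt ℝ (pd K j f) x :=
    differentiableAt_of_smoothOn hS (contDiffOn_pd hS hf K j) hx
  have hc (K : Fin m) (i j : Fin 3) : DifferentiableAt ℝ (fun y : Conf m => A i j * y K i) x := by
    fun_prop
  have ht (K : Fin m) (i j : Fin 3) :
      DifferentiableAt ℝ (fun y : Conf m => A i j * y K i * pd K j f y) x :=
    (hc K i j).mul (hpd K j)
  have term (K : Fin m) (i j : Fin 3) :
      pd J a (fun y => A i j * y K i * pd K j f y) x =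
        (if K = J then if i = a then A i j * pd K j f x else 0 else 0) +
          A i j * x K i * pd K j (pd J a f) x := by
    rw [pd_mul (hc K i j) (hpd K j), pd_const_mul (by fun_prop), pd_coord,
      pd_comm hS hf hx J K a j]
    by_cases hK : K = J <;> by_cases hi : i = a <;> simp [hK, hi]
  have h1 : pd J a (collective A f) x =
      ∑ K, ∑ i, ∑ j, pd J a (fun y => A i j * y K i * pd K j f y) x := by
    unfold collective
    rw [pd_sum _ fun K _ => DifferentiableAt.fun_sum fun i _ =>
      DifferentiableAt.fun_sum fun j _ => ht K i j]
    refine Finset.sum_congr rfl fun K _ => ?_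
    rw [pd_sum _ fun i _ => DifferentiableAt.fun_sum fun j _ => ht K i j]
    refine Finset.sum_congr rfl fun i _ => ?_
    rw [pd_sum _ fun j _ => ht K i j]
  rw [h1]
  simp only [term, Finset.sum_add_distrib, collective]
  congr 1
  rw [Finset.sum_eq_single J (fun K _ hK => by simp [hK]) (by simp),
    Finset.sum_eq_single a (fun i _ hi => by simp [hi]) (by simp)]
  simp

theorem pd_pd_collective (hS : IsOpen S) (hf : ContDiffOn ℝ (⊤ : ℕ∞) f S) (hx : x ∈ S)
    (A : Fin 3 → Fin 3 → ℝ) (I J : Fin m) (b a : Fin 3) :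
    pd I b (pd J a (collective A f)) x =
      ∑ j, A a j * pd I b (pd J j f) x + ∑ j, A b j * pd I j (pd J a f) x +
        collective A (pd I b (pd J a f)) x := by
  have hpd (j : Fin 3) := contDiffOn_pd hS hf J j
  have hd (j : Fin 3) := differentiableAt_of_smoothOn hS (hpd j) hx
  rw [pd_congr hS (fun y hy => pd_collective hS hf hy A J a) hx,
    pd_add (DifferentiableAt.fun_sum fun j _ => (hd j).const_mul _)
      (differentiableAt_of_smoothOn hS (contDiffOn_collective hS (hpd a) A) hx),
    pd_sum _ fun j _ => (hd j).const_mul _, pd_collective hS (hpd a) hx]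
  simp only [pd_const_mul (hd _)]
  ring

theorem pdC_add_I_mul (hf : DifferentiableAt ℝ f x) (hg : DifferentiableAt ℝ g x) (K : Fin m)
    (i : Fin 3) : pdC K i (fun y => (f y : ℂ) + Complex.I * (g y : ℂ)) x =
      (pd K i f x : ℂ) + Complex.I * (pd K i g x : ℂ) := by
  have hf' : HasFDerivAt (fun y => (f y : ℂ)) (Complex.ofRealCLM.comp (fderiv ℝ f x)) x :=
    Complex.ofRealCLM.hasFDerivAt.comp x hf.hasFDerivAt
  have hg' : HasFDerivAt (fun y => (g y : ℂ)) (Complex.ofRealCLM.comp (fderiv ℝ g x)) x :=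
    Complex.ofRealCLM.hasFDerivAt.comp x hg.hasFDerivAt
  rw [pdC, (hf'.fun_add (hg'.const_mul Complex.I)).fderiv]
  simp [pd]

theorem pdC_pdC_add_I_mul (hS : IsOpen S) (hf : ContDiffOn ℝ (⊤ : ℕ∞) f S)
    (hg : ContDiffOn ℝ (⊤ : ℕ∞) g S) (hx : x ∈ S) (I J : Fin m) (i j : Fin 3) :
    pdC I i (pdC J j (fun y => (f y : ℂ) + Complex.I * (g y : ℂ))) x =
      (pd I i (pd J j f) x : ℂ) + Complex.I * (pd I i (pd J j g) x : ℂ) := by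
  have h : pdC J j (fun y => (f y : ℂ) + Complex.I * (g y : ℂ)) =ᶠ[nhds x]
      fun y => (pd J j f y : ℂ) + Complex.I * (pd J j g y : ℂ) :=
    Filter.eventually_of_mem (hS.mem_nhds hx) fun y hy =>
      pdC_add_I_mul (differentiableAt_of_smoothOn hS hf hy)
        (differentiableAt_of_smoothOn hS hg hy) J j
  rw [pdC, h.fderiv_eq]
  exact pdC_add_I_mul (differentiableAt_of_smoothOn hS (contDiffOn_pd hS hf J j) hx)
    (differentiableAt_of_smoothOn hS (contDiffOn_pd hS hg J j) hx) I i

end Derivatives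

section LindstromRocek

variable {m : ℕ} {S : Set (Conf m)} {L : Conf m → ℝ} {x : Conf m}

theorem pd_pd_swap_of_curl
    (hcurl : ∀ I J : Fin m, ∀ x ∈ S, ∀ k : Fin 3,
      ∑ i : Fin 3, ∑ j : Fin 3, eps k i j * pd I i (pd J j L) x = 0)
    (hx : x ∈ S) (I J : Fin m) (i j : Fin 3) :
    pd I i (pd J j L) x = pd I j (pd J i L) x := by
  have h0 := hcurl I J x hx 0
  have h1 := hcurl I J x hx 1
  have h2 := hcurl I J x hx 2
  simp only [Fin.sum_univ_three, eps, Fin.val_zero, Fin.val_one, Fin.val_two, Nat.cast_zero,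
    Nat.cast_one, Nat.cast_ofNat] at h0 h1 h2
  fin_cases i <;> fin_cases j <;> simp only [Fin.zero_eta, Fin.mk_one, Fin.reduceFinMk] <;> linarith

theorem pd_pd_pd_swap_right (hS : IsOpen S)
    (hcurl : ∀ I J : Fin m, ∀ x ∈ S, ∀ k : Fin 3,
      ∑ i : Fin 3, ∑ j : Fin 3, eps k i j * pd I i (pd J j L) x = 0)
    (hx : x ∈ S) (K I J : Fin m) (a b c : Fin 3) :
    pd K a (pd I b (pd J c L)) x = pd K a (pd I c (pd J b L)) x :=
  pd_congr hS (fun _ hy => pd_pd_swap_of_curl hcurl hy I J b c) hx K a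

theorem pd_pd_pd_swap_left (hS : IsOpen S) (hL : ContDiffOn ℝ (⊤ : ℕ∞) L S)
    (hcurl : ∀ I J : Fin m, ∀ x ∈ S, ∀ k : Fin 3,
      ∑ i : Fin 3, ∑ j : Fin 3, eps k i j * pd I i (pd J j L) x = 0)
    (hx : x ∈ S) (K I J : Fin m) (a b c : Fin 3) :
    pd K a (pd I b (pd J c L)) x = pd K b (pd I a (pd J c L)) x := by
  have h (a b : Fin 3) :
      pd K a (pd I b (pd J c L)) x = pd J c (pd K a (pd I b L)) x := by
    rw [pd_congr hS (fun y hy => pd_comm hS hL hy I J b c) hx,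
      pd_comm hS (contDiffOn_pd hS hL I b) hx]
  rw [h, h, pd_pd_pd_swap_right hS hcurl hx J K I c a b]

theorem pd_trace_eq_zero (hS : IsOpen S) (hL : ContDiffOn ℝ (⊤ : ℕ∞) L S)
    (hLap : ∀ I J : Fin m, ∀ x ∈ S, ∑ i : Fin 3, pd I i (pd J i L) x = 0)
    (hx : x ∈ S) (K I J : Fin m) (a : Fin 3) :
    ∑ i : Fin 3, pd K a (pd I i (pd J i L)) x = 0 := by
  rw [← pd_sum _ fun i _ => differentiableAt_of_smoothOn hS
    (contDiffOn_pd hS (contDiffOn_pd hS hL J i) I i) hx,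
    pd_congr hS (g := fun _ => 0) (hLap I J) hx]
  simp [pd]

theorem Lrot_zero_add_L0 (hS : IsOpen S) (hL : ContDiffOn ℝ (⊤ : ℕ∞) L S)
    (hLap : ∀ I J : Fin m, ∀ x ∈ S, ∑ i : Fin 3, pd I i (pd J i L) x = 0)
    (hcurl : ∀ I J : Fin m, ∀ x ∈ S, ∀ k : Fin 3,
      ∑ i : Fin 3, ∑ j : Fin 3, eps k i j * pd I i (pd J j L) x = 0)
    (hx : x ∈ S) (I J : Fin m) :
    Lrot 0 (pd I 1 (pd J 0 L)) x + L0 (pd I 2 (pd J 0 L)) x = Lrot 1 (pd I 0 (pd J 0 L)) x := by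
  simp only [Lrot_eq_collective, L0_eq_collective, collective, ← Finset.sum_add_distrib]
  refine Finset.sum_congr rfl fun K _ => ?_
  have r := pd_pd_pd_swap_right hS hcurl hx K I J
  have l := pd_pd_pd_swap_left hS hL hcurl hx K I J
  have t := pd_trace_eq_zero hS hL hLap hx K I J 0
  simp only [Fin.sum_univ_three] at t
  simp [Fin.sum_univ_three, eps]
  linear_combination x K 0 * l 0 2 0 + x K 1 * l 1 2 0 +
    x K 2 * (t + l 2 0 2 + l 1 0 1 + r 2 2 0 + r 1 1 0)

theorem L0_sub_Lrot_zero (hS : IsOpen S) (hL : ContDiffOn ℝ (⊤ : ℕ∞) L S)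
    (hLap : ∀ I J : Fin m, ∀ x ∈ S, ∑ i : Fin 3, pd I i (pd J i L) x = 0)
    (hcurl : ∀ I J : Fin m, ∀ x ∈ S, ∀ k : Fin 3,
      ∑ i : Fin 3, ∑ j : Fin 3, eps k i j * pd I i (pd J j L) x = 0)
    (hx : x ∈ S) (I J : Fin m) :
    L0 (pd I 1 (pd J 0 L)) x - Lrot 0 (pd I 2 (pd J 0 L)) x =
      -Lrot 2 (pd I 0 (pd J 0 L)) x := by
  simp only [Lrot_eq_collective, L0_eq_collective, collective, ← Finset.sum_sub_distrib,
    ← Finset.sum_neg_distrib]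
  refine Finset.sum_congr rfl fun K _ => ?_
  have r := pd_pd_pd_swap_right hS hcurl hx K I J
  have l := pd_pd_pd_swap_left hS hL hcurl hx K I J
  have t := pd_trace_eq_zero hS hL hLap hx K I J 0
  simp only [Fin.sum_univ_three] at t
  simp [Fin.sum_univ_three, eps]
  linear_combination x K 0 * l 0 1 0 - x K 2 * l 1 2 0 +
    x K 1 * (t + l 2 0 2 + l 1 0 1 + r 2 2 0 + r 1 1 0)

end LindstromRocek

/-- for an `L`-potential satisfying the Lindström–Roček
constraints, with Higgs field `U_{IJ} = −½ ∂_{I,1}∂_{J,1}L` and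
`G = L₁(L) + i(L₀(L) − L)`, the kernel conditions
`∂_{I,1}∂_{J,1}G = 0` and `∂_{z^I}∂_{J,1}G = 0` are equivalent to the
rotation invariance and degree `−1` homogeneity of the Higgs field
(indices `1,2,3` of the paper correspond to `0,1,2` in `Fin 3`). -/
theorem stmt9 {m : ℕ} (hm : 1 ≤ m) (S : Set (Conf m)) (hS : IsOpen S)
    (L : Conf m → ℝ) (hsmooth : ContDiffOn ℝ (⊤ : ℕ∞) L S)
    (hLap : ∀ I J : Fin m, ∀ x ∈ S, ∑ i : Fin 3, pd I i (pd J i L) x = 0)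
    (hcurl : ∀ I J : Fin m, ∀ x ∈ S, ∀ k : Fin 3,
      ∑ i : Fin 3, ∑ j : Fin 3, eps k i j * pd I i (pd J j L) x = 0)
    (UIJ : Fin m → Fin m → Conf m → ℝ)
    (hUIJ : ∀ I J, UIJ I J = fun x => -(1/2) * pd I 0 (pd J 0 L) x)
    (G : Conf m → ℂ)
    (hG : G = fun x => (Lrot 0 L x : ℂ) + Complex.I * ((L0 L x : ℂ) - (L x : ℂ))) :
    (∀ I J : Fin m, ∀ x ∈ S,
      pdC I 0 (pdC J 0 G) x = 0 ∧
      pdC I 1 (pdC J 0 G) x - Complex.I * pdC I 2 (pdC J 0 G) x = 0) ↔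
    (∀ I J : Fin m, ∀ x ∈ S,
      (∀ k : Fin 3, Lrot k (UIJ I J) x = 0) ∧
      L0 (UIJ I J) x = -(UIJ I J x)) := by
  have hf : ContDiffOn ℝ (⊤ : ℕ∞) (Lrot 0 L) S := by
    rw [Lrot_eq_collective]
    exact contDiffOn_collective hS hsmooth _
  have h0 : ContDiffOn ℝ (⊤ : ℕ∞) (L0 L) S := by
    rw [L0_eq_collective]
    exact contDiffOn_collective hS hsmooth _
  have hg : ContDiffOn ℝ (⊤ : ℕ∞) (fun y => L0 L y - L y) S := h0.sub hsmooth
  have hG' : G = fun y => (Lrot 0 L y : ℂ) + Complex.I * ((L0 L y - L y : ℝ) : ℂ) := by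
    simp [hG]
  refine forall_congr' fun I => forall_congr' fun J => forall_congr' fun x =>
    forall_congr' fun hx => ?_
  have hGpd (b : Fin 3) := pdC_pdC_add_I_mul hS hf hg hx I J b 0
  have hre (b : Fin 3) : pd I b (pd J 0 (Lrot 0 L)) x =
      -(∑ j, eps 0 b j * pd I j (pd J 0 L) x) + Lrot 0 (pd I b (pd J 0 L)) x := by
    rw [Lrot_eq_collective, Lrot_eq_collective, pd_pd_collective hS hsmooth hx]
    simp [eps]
  have him (b : Fin 3) : pd I b (pd J 0 (fun y => L0 L y - L y)) x =
      pd I b (pd J 0 L) x + L0 (pd I b (pd J 0 L)) x := by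
    rw [pd_congr hS (fun y hy => pd_sub (differentiableAt_of_smoothOn hS h0 hy)
        (differentiableAt_of_smoothOn hS hsmooth hy) J 0) hx,
      pd_sub (differentiableAt_of_smoothOn hS (contDiffOn_pd hS h0 J 0) hx)
        (differentiableAt_of_smoothOn hS (contDiffOn_pd hS hsmooth J 0) hx),
      L0_eq_collective, L0_eq_collective, pd_pd_collective hS hsmooth hx]
    simp
    ring
  have hU0 : L0 (UIJ I J) x = -(1/2) * L0 (pd I 0 (pd J 0 L)) x := by
    rw [hUIJ, L0_eq_collective, L0_eq_collective]
    exact collective_const_mul hS (contDiffOn_pd hS (contDiffOn_pd hS hsmooth J 0) I 0) hx _ _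
  have hU (k : Fin 3) : Lrot k (UIJ I J) x = -(1/2) * Lrot k (pd I 0 (pd J 0 L)) x := by
    rw [hUIJ, Lrot_eq_collective, Lrot_eq_collective]
    exact collective_const_mul hS (contDiffOn_pd hS (contDiffOn_pd hS hsmooth J 0) I 0) hx _ _
  have hUx : UIJ I J x = -(1/2) * pd I 0 (pd J 0 L) x := by rw [hUIJ]
  have key1 := Lrot_zero_add_L0 hS hsmooth hLap hcurl hx I J
  have key2 := L0_sub_Lrot_zero hS hsmooth hLap hcurl hx I J
  rw [hG', hGpd, hGpd, hGpd, hU0, hUx]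
  simp only [hU, hre, him]
  simp only [Complex.ext_iff, Fin.forall_fin_succ, Fin.sum_univ_three]
  simp [eps]
  constructor
  · rintro ⟨⟨h1, h2⟩, h3, h4⟩
    refine ⟨⟨?_, ?_, ?_⟩, ?_⟩ <;> linarith
  · rintro ⟨⟨h1, h2, h3⟩, h4⟩
    refine ⟨⟨?_, ?_⟩, ?_, ?_⟩ <;> linarith
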